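/- arXiv:2605.01080 — 7 statements merged into one kernel-verified Lean document; each statement's English description precedes it below -/
import Mathlib

section
/- Set C₀ := max_{θ∈{0,1}} max(|∂c(θ,a_min)/∂α|, |∂c(θ,a_max)/∂α|) and let C ≥ max(1, 2C₀). If z⁰, z¹ ∈ ℝ satisfy |z⁰ + z¹| ≥ C·(1 + |z⁰ − z¹|), then z⁰ and z¹ have the same sign, min(|z⁰|,|z¹|) ≥ C₀, and A⁰(z⁰) = A¹(z¹) ∈ {a_min, a_max}; in particular λ̄(p,z⁰,z¹) = A⁰(z⁰) is independent of p ∈ [0,1] and A⁰(z⁰) − A¹(z¹) = 0. -/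
/-- `α` is a maximizer of `α ↦ z·α − c(θ,α)` over `A = [a_min, a_max]`. -/
def IsMaximizer (a_min a_max : ℝ) (c : Fin 2 → ℝ → ℝ) (θ : Fin 2) (z α : ℝ) : Prop :=
  α ∈ Set.Icc a_min a_max ∧
    ∀ β ∈ Set.Icc a_min a_max, z * β - c θ β ≤ z * α - c θ α

theorem deriv_strictMono (a b ρ : ℝ) (hρ : 0 < ρ) (g g' : ℝ → ℝ)
    (hg : ∀ x ∈ Set.Icc a b, HasDerivAt g (g' x) x)
    (h : ∀ x ∈ Set.Icc a b, ρ ≤ g' x) : StrictMonoOn g (Set.Icc a b) := by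
  apply strictMonoOn_of_deriv_pos (convex_Icc a b)
  · exact fun x hx => (hg x hx).continuousAt.continuousWithinAt
  · intro x hx
    have hx' := interior_subset hx
    rw [(hg x hx').deriv]
    linarith [h x hx']

theorem max_top (a b z x : ℝ) (hab : a < b) (f f' : ℝ → ℝ)
    (hf : ∀ x ∈ Set.Icc a b, HasDerivAt f (f' x) x)
    (hm : StrictMonoOn f' (Set.Icc a b)) (hz : f' b ≤ z)
    (hx : x ∈ Set.Icc a b) (hmax : ∀ y ∈ Set.Icc a b, z * y - f y ≤ z * x - f x) : x = b := by
  have hd : ∀ y ∈ Set.Icc a b, HasDerivAt (fun y => z * y - f y) (z - f' y) y := by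
    intro y hy
    have h := ((hasDerivAt_id y).const_mul z).sub (hf y hy)
    rw [mul_one] at h
    exact h
  have hs : StrictMonoOn (fun y => z * y - f y) (Set.Icc a b) := by
    apply strictMonoOn_of_deriv_pos (convex_Icc a b)
    · exact fun x hx => (hd x hx).continuousAt.continuousWithinAt
    · intro y hy
      have hy' := interior_subset hy
      rw [(hd y hy').deriv]
      rw [interior_Icc] at hy
      linarith [hm hy' (Set.right_mem_Icc.2 hab.le) hy.2]
  by_contra hne
  have h1 := hs hx (Set.right_mem_Icc.2 hab.le) (lt_of_le_of_ne hx.2 hne)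
  have h2 := hmax b (Set.right_mem_Icc.2 hab.le)
  simp only at h1
  linarith

theorem max_bot (a b z x : ℝ) (hab : a < b) (f f' : ℝ → ℝ)
    (hf : ∀ x ∈ Set.Icc a b, HasDerivAt f (f' x) x)
    (hm : StrictMonoOn f' (Set.Icc a b)) (hz : z ≤ f' a)
    (hx : x ∈ Set.Icc a b) (hmax : ∀ y ∈ Set.Icc a b, z * y - f y ≤ z * x - f x) : x = a := by
  have hd : ∀ y ∈ Set.Icc a b, HasDerivAt (fun y => z * y - f y) (z - f' y) y := by
    intro y hy
    have h := ((hasDerivAt_id y).const_mul z).sub (hf y hy)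
    rw [mul_one] at h
    exact h
  have hs : StrictAntiOn (fun y => z * y - f y) (Set.Icc a b) := by
    apply strictAntiOn_of_deriv_neg (convex_Icc a b)
    · exact fun x hx => (hd x hx).continuousAt.continuousWithinAt
    · intro y hy
      have hy' := interior_subset hy
      rw [(hd y hy').deriv]
      rw [interior_Icc] at hy
      linarith [hm (Set.left_mem_Icc.2 hab.le) hy' hy.1]
  by_contra hne
  have h1 := hs (Set.left_mem_Icc.2 hab.le) hx (lt_of_le_of_ne hx.1 (Ne.symm hne))
  have h2 := hmax a (Set.left_mem_Icc.2 hab.le)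
  simp only at h1
  linarith

/-- With `C₀ := max_θ max(|∂c(θ,a_min)/∂α|, |∂c(θ,a_max)/∂α|)` and `C ≥ max(1, 2C₀)`:
if `|z⁰ + z¹| ≥ C(1 + |z⁰ − z¹|)`, then `z⁰, z¹` have the same sign,
`min(|z⁰|,|z¹|) ≥ C₀`, `A⁰(z⁰) = A¹(z¹) ∈ {a_min, a_max}`; so
`λ̄(p,z⁰,z¹) = A⁰(z⁰)` is independent of `p` and `A⁰(z⁰) − A¹(z¹) = 0`. -/
theorem stmt_8
    (a_min a_max ρ N0 C0 C : ℝ)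
    (hA : a_min < a_max) (hρ : 0 < ρ)
    (c c' c'' : Fin 2 → ℝ → ℝ)
    (hc' : ∀ θ : Fin 2, ∀ α ∈ Set.Icc a_min a_max, HasDerivAt (c θ) (c' θ α) α)
    (hc'' : ∀ θ : Fin 2, ∀ α ∈ Set.Icc a_min a_max, HasDerivAt (c' θ) (c'' θ α) α)
    (hc''cont : ∀ θ : Fin 2, ContinuousOn (c'' θ) (Set.Icc a_min a_max))
    (hconv : ∀ θ : Fin 2, ∀ α ∈ Set.Icc a_min a_max, ρ ≤ c'' θ α)
    (hN0 : ∀ θ : Fin 2, ∀ α ∈ Set.Icc a_min a_max, |c' θ α| + |α| ≤ N0)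
    (Amax : Fin 2 → ℝ → ℝ)
    (hAmax : ∀ θ : Fin 2, ∀ z : ℝ, IsMaximizer a_min a_max c θ z (Amax θ z))
    (hC0 : C0 = max (max |c' 0 a_min| |c' 0 a_max|) (max |c' 1 a_min| |c' 1 a_max|))
    (hC : max 1 (2 * C0) ≤ C) :
    ∀ z0 z1 : ℝ, C * (1 + |z0 - z1|) ≤ |z0 + z1| →
      (0 ≤ z0 * z1) ∧
      (C0 ≤ min |z0| |z1|) ∧
      (Amax 0 z0 = Amax 1 z1) ∧
      (Amax 0 z0 = a_min ∨ Amax 0 z0 = a_max) ∧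
      (∀ p ∈ Set.Icc (0:ℝ) 1, p * Amax 0 z0 + (1 - p) * Amax 1 z1 = Amax 0 z0) ∧
      (Amax 0 z0 - Amax 1 z1 = 0) := by
  intro z0 z1 hz
  have hC1 : 1 ≤ C := (le_max_left _ _).trans hC
  have hC2 : 2 * C0 ≤ C := (le_max_right _ _).trans hC
  have hmono := fun θ => deriv_strictMono a_min a_max ρ hρ (c' θ) (c'' θ) (hc'' θ) (hconv θ)
  have hb : ∀ θ : Fin 2, |c' θ a_min| ≤ C0 ∧ |c' θ a_max| ≤ C0 := by
    rw [hC0]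
    intro θ
    fin_cases θ <;> simp
  have htop : ∀ θ z, C0 ≤ z → Amax θ z = a_max := fun θ z h =>
    max_top a_min a_max z _ hA (c θ) (c' θ) (hc' θ) (hmono θ)
      (((le_abs_self _).trans (hb θ).2).trans h) (hAmax θ z).1 (hAmax θ z).2
  have hbot : ∀ θ z, z ≤ -C0 → Amax θ z = a_min := fun θ z h =>
    max_bot a_min a_max z _ hA (c θ) (c' θ) (hc' θ) (hmono θ)
      (by linarith [neg_abs_le (c' θ a_min), (hb θ).1]) (hAmax θ z).1 (hAmax θ z).2
  have hd : C + |z0 - z1| ≤ |z0 + z1| := by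
    nlinarith [abs_nonneg (z0 - z1)]
  have h1 := le_abs_self (z0 - z1)
  have h2 := neg_abs_le (z0 - z1)
  rcases abs_cases (z0 + z1) with ⟨h, _⟩ | ⟨h, _⟩
  · have e0 : C / 2 ≤ z0 := by linarith
    have e1 : C / 2 ≤ z1 := by linarith
    have t0 := htop 0 z0 (by linarith)
    have t1 := htop 1 z1 (by linarith)
    refine ⟨mul_nonneg (by linarith) (by linarith), le_min ?_ ?_, by rw [t0, t1], Or.inr t0, ?_, ?_⟩
    · linarith [le_abs_self z0]
    · linarith [le_abs_self z1]
    · intro p _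
      rw [t0, t1]; ring
    · rw [t0, t1]; ring
  · have e0 : z0 ≤ -(C / 2) := by linarith
    have e1 : z1 ≤ -(C / 2) := by linarith
    have t0 := hbot 0 z0 (by linarith)
    have t1 := hbot 1 z1 (by linarith)
    refine ⟨mul_nonneg_of_nonpos_of_nonpos (by linarith) (by linarith), le_min ?_ ?_,
      by rw [t0, t1], Or.inl t0, ?_, ?_⟩
    · linarith [neg_le_abs z0]
    · linarith [neg_le_abs z1]
    · intro p _
      rw [t0, t1]; ring
    · rw [t0, t1]; ring
end

section
/- Let 𝔠 ∈ {a̲, ā} and let (zⁿ)_{n≥1} ⊂ ℝ be a sequence with H⁰(zⁿ) − H¹(zⁿ) → 𝔠. Then there exist a subsequence (z^{n_k})_{k≥1} and a sequence (z̃^k)_{k≥1} ⊂ ℝ such that H⁰(z̃^k) − H¹(z̃^k) = 𝔠 for every k and z^{n_k} − z̃^k → 0 as k → ∞. In particular the level sets {z : H⁰(z) − H¹(z) = a̲} and {z : H⁰(z) − H¹(z) = ā} are nonempty. -/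
/-- The Hamiltonian `H^θ(z) := sup_{α ∈ A} (z·α − c(θ,α))`. -/
noncomputable def Ham (a_min a_max : ℝ) (c : Fin 2 → ℝ → ℝ) (θ : Fin 2) (z : ℝ) : ℝ :=
  sSup ((fun α => z * α - c θ α) '' Set.Icc a_min a_max)

theorem ham_continuous (a b : ℝ) (hA : a < b) (c : Fin 2 → ℝ → ℝ) (θ : Fin 2)
    (hc : ContinuousOn (c θ) (Set.Icc a b)) : Continuous (Ham a b c θ) := by
  have hext : Continuous (Set.IccExtend hA.le (Set.domRestrict (Set.Icc a b) (c θ))) :=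
    (continuousOn_iff_continuous_domRestrict.1 hc).Icc_extend'
  have h : Continuous fun z : ℝ => sSup ((fun α : ℝ => z * α -
      Set.IccExtend hA.le (Set.domRestrict (Set.Icc a b) (c θ)) α) '' Set.Icc a b) := by
    apply IsCompact.continuous_sSup isCompact_Icc
    apply Continuous.sub
    · exact continuous_fst.mul continuous_snd
    · exact hext.comp continuous_snd
  refine h.congr fun z => ?_
  unfold Ham
  congr 1
  apply Set.image_congr
  intro α hα
  rw [Set.IccExtend_of_mem _ _ hα]
  rfl

theorem ham_high (a b N0 : ℝ) (hA : a < b) (c c' : Fin 2 → ℝ → ℝ) (θ : Fin 2)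
    (hc' : ∀ α ∈ Set.Icc a b, HasDerivAt (c θ) (c' θ α) α)
    (hN : ∀ α ∈ Set.Icc a b, |c' θ α| ≤ N0) (z : ℝ) (hz : N0 ≤ z) :
    Ham a b c θ z = z * b - c θ b := by
  have hd : ∀ α ∈ Set.Icc a b, HasDerivAt (fun α => z * α - c θ α) (z - c' θ α) α := by
    intro α hα
    have h := ((hasDerivAt_id α).const_mul z).sub (hc' α hα)
    rw [mul_one] at h
    exact h
  have hm : MonotoneOn (fun α => z * α - c θ α) (Set.Icc a b) := by
    apply monotoneOn_of_deriv_nonneg (convex_Icc a b)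
    · exact fun α hα => (hd α hα).continuousAt.continuousWithinAt
    · exact fun α hα => (hd α (interior_subset hα)).differentiableAt.differentiableWithinAt
    · intro α hα
      rw [(hd α (interior_subset hα)).deriv]
      have := (abs_le.1 (hN α (interior_subset hα))).2
      linarith
  exact (hm.map_isGreatest (isGreatest_Icc hA.le)).csSup_eq

theorem ham_low (a b N0 : ℝ) (hA : a < b) (c c' : Fin 2 → ℝ → ℝ) (θ : Fin 2)
    (hc' : ∀ α ∈ Set.Icc a b, HasDerivAt (c θ) (c' θ α) α)
    (hN : ∀ α ∈ Set.Icc a b, |c' θ α| ≤ N0) (z : ℝ) (hz : z ≤ -N0) :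
    Ham a b c θ z = z * a - c θ a := by
  have hd : ∀ α ∈ Set.Icc a b, HasDerivAt (fun α => z * α - c θ α) (z - c' θ α) α := by
    intro α hα
    have h := ((hasDerivAt_id α).const_mul z).sub (hc' α hα)
    rw [mul_one] at h
    exact h
  have hm : AntitoneOn (fun α => z * α - c θ α) (Set.Icc a b) := by
    apply antitoneOn_of_deriv_nonpos (convex_Icc a b)
    · exact fun α hα => (hd α hα).continuousAt.continuousWithinAt
    · exact fun α hα => (hd α (interior_subset hα)).differentiableAt.differentiableWithinAt
    · intro α hα
      rw [(hd α (interior_subset hα)).deriv]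
      have := (abs_le.1 (hN α (interior_subset hα))).1
      linarith
  exact (hm.map_isLeast (isLeast_Icc hA.le)).csSup_eq

theorem core_seq (D : ℝ → ℝ) (N : ℝ) (hN : 0 ≤ N) (hD : Continuous D)
    (hhi : ∀ z, N ≤ z → D z = D N) (hlo : ∀ z, z ≤ -N → D z = D (-N)) :
    (∀ (x : ℝ) (z : ℕ → ℝ), Filter.Tendsto (fun n => D (z n)) Filter.atTop (nhds x) →
      ∃ φ : ℕ → ℕ, StrictMono φ ∧ ∃ zt : ℕ → ℝ, (∀ k, D (zt k) = x) ∧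
        Filter.Tendsto (fun k => z (φ k) - zt k) Filter.atTop (nhds 0)) ∧
    (∃ z, D z = sInf (Set.range D)) ∧ (∃ z, D z = sSup (Set.range D)) := by
  have hp : ∀ z, ∃ p ∈ Set.Icc (-N) N, D z = D p ∧ (-N < z → z < N → p = z) := by
    intro z
    rcases le_or_gt N z with h | h
    · exact ⟨N, ⟨by linarith, le_rfl⟩, hhi z h, fun _ h2 => absurd h2 (not_lt.2 h)⟩
    rcases le_or_gt z (-N) with h' | h'
    · exact ⟨-N, ⟨le_rfl, by linarith⟩, hlo z h', fun h2 _ => absurd h2 (not_lt.2 h')⟩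
    · exact ⟨z, ⟨h'.le, h.le⟩, rfl, fun _ _ => rfl⟩
  choose p hpm hpD hpe using hp
  have hr : Set.range D = D '' Set.Icc (-N) N := by
    ext y
    constructor
    · rintro ⟨z, rfl⟩
      exact ⟨p z, hpm z, (hpD z).symm⟩
    · rintro ⟨z, _, rfl⟩
      exact ⟨z, rfl⟩
  have hc : IsCompact (Set.range D) := hr ▸ isCompact_Icc.image hD
  refine ⟨?_, hc.sInf_mem (Set.range_nonempty D), hc.sSup_mem (Set.range_nonempty D)⟩
  intro x z hz
  obtain ⟨w, _, φ, hφ, hw⟩ := isCompact_Icc.tendsto_subseq (fun n => hpm (z n))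
  have hzφ := hz.comp hφ.tendsto_atTop
  have hDw : D w = x := by
    refine tendsto_nhds_unique ((hD.tendsto w).comp hw) (hzφ.congr fun k => ?_)
    exact hpD _
  classical
  refine ⟨φ, hφ, fun k => if D (z (φ k)) = x then z (φ k) else w, ?_, ?_⟩
  · intro k
    dsimp only
    split_ifs with h
    · exact h
    · exact hDw
  have key : ∀ y, ∀ᶠ k in Filter.atTop, D (z (φ k)) = y → y = x := by
    intro y
    by_cases hy : y = x
    · exact Filter.Eventually.of_forall fun _ _ => hy
    · filter_upwards [hzφ.eventually_ne (Ne.symm hy)] with k hk h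
      exact absurd h hk
  have h0 : Filter.Tendsto (fun k => |p (z (φ k)) - w|) Filter.atTop (nhds 0) := by
    have := (hw.sub_const w).abs
    simpa using this
  refine squeeze_zero_norm' ?_ h0
  filter_upwards [key (D N), key (D (-N))] with k h1 h2
  split_ifs with h
  · simp
  · have e : p (z (φ k)) = z (φ k) := by
      apply hpe
      · by_contra hh
        have := hlo _ (not_lt.1 hh)
        exact h (this.trans (h2 this))
      · by_contra hh
        have := hhi _ (not_lt.1 hh)
        exact h (this.trans (h1 this))
    rw [e, Real.norm_eq_abs]

/-- Let `𝔠 ∈ {a̲, ā}` and `(zⁿ)` a sequence with `H⁰(zⁿ) − H¹(zⁿ) → 𝔠`. Then there is a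
subsequence `(z^{n_k})` and a sequence `(z̃^k)` with `H⁰(z̃^k) − H¹(z̃^k) = 𝔠` for all `k`
and `z^{n_k} − z̃^k → 0`. In particular the level sets at `a̲` and `ā` are nonempty. -/
theorem stmt_9
    (a_min a_max ρ N0 : ℝ)
    (hA : a_min < a_max) (hρ : 0 < ρ)
    (c c' c'' : Fin 2 → ℝ → ℝ)
    (hc' : ∀ θ : Fin 2, ∀ α ∈ Set.Icc a_min a_max, HasDerivAt (c θ) (c' θ α) α)
    (hc'' : ∀ θ : Fin 2, ∀ α ∈ Set.Icc a_min a_max, HasDerivAt (c' θ) (c'' θ α) α)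
    (hc''cont : ∀ θ : Fin 2, ContinuousOn (c'' θ) (Set.Icc a_min a_max))
    (hconv : ∀ θ : Fin 2, ∀ α ∈ Set.Icc a_min a_max, ρ ≤ c'' θ α)
    (hN0 : ∀ θ : Fin 2, ∀ α ∈ Set.Icc a_min a_max, |c' θ α| + |α| ≤ N0)
    (𝔠 : ℝ)
    (h𝔠 : 𝔠 = sInf (Set.range fun z => Ham a_min a_max c 0 z - Ham a_min a_max c 1 z) ∨
          𝔠 = sSup (Set.range fun z => Ham a_min a_max c 0 z - Ham a_min a_max c 1 z))
    (zseq : ℕ → ℝ)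
    (hconv' : Filter.Tendsto
        (fun n => Ham a_min a_max c 0 (zseq n) - Ham a_min a_max c 1 (zseq n))
        Filter.atTop (nhds 𝔠)) :
    (∃ φ : ℕ → ℕ, StrictMono φ ∧ ∃ zt : ℕ → ℝ,
        (∀ k, Ham a_min a_max c 0 (zt k) - Ham a_min a_max c 1 (zt k) = 𝔠) ∧
        Filter.Tendsto (fun k => zseq (φ k) - zt k) Filter.atTop (nhds 0)) ∧
    (∃ z : ℝ, Ham a_min a_max c 0 z - Ham a_min a_max c 1 z
        = sInf (Set.range fun w => Ham a_min a_max c 0 w - Ham a_min a_max c 1 w)) ∧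
    (∃ z : ℝ, Ham a_min a_max c 0 z - Ham a_min a_max c 1 z
        = sSup (Set.range fun w => Ham a_min a_max c 0 w - Ham a_min a_max c 1 w)) := by
  have hN : ∀ θ : Fin 2, ∀ α ∈ Set.Icc a_min a_max, |c' θ α| ≤ N0 := fun θ α hα => by
    linarith [hN0 θ α hα, abs_nonneg α]
  have hNn : 0 ≤ N0 := (abs_nonneg _).trans (hN 0 a_min ⟨le_rfl, hA.le⟩)
  have hcc : ∀ θ, Continuous (Ham a_min a_max c θ) := fun θ =>
    ham_continuous a_min a_max hA c θ
      fun α hα => (hc' θ α hα).continuousAt.continuousWithinAt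
  have hh := fun θ => ham_high a_min a_max N0 hA c c' θ (hc' θ) (hN θ)
  have hl := fun θ => ham_low a_min a_max N0 hA c c' θ (hc' θ) (hN θ)
  obtain ⟨h1, h2, h3⟩ := core_seq (fun z => Ham a_min a_max c 0 z - Ham a_min a_max c 1 z) N0 hNn
    ((hcc 0).sub (hcc 1))
    (fun z hz => by
      rw [hh 0 z hz, hh 1 z hz, hh 0 N0 le_rfl, hh 1 N0 le_rfl]; ring)
    (fun z hz => by
      rw [hl 0 z hz, hl 1 z hz, hl 0 (-N0) le_rfl, hl 1 (-N0) le_rfl]; ring)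
  exact ⟨h1 𝔠 zseq hconv', h2, h3⟩
end

section
/- Assume C ≥ 0 is such that |H¹(z¹) − H⁰(z⁰)| ≤ C(1+|z⁰−z¹|) and |H⁰(z⁰) + H¹(z¹) − λ̄(p,z⁰,z¹)(z⁰+z¹)| ≤ C(1+|z⁰−z¹|) for all p ∈ [0,1] and z⁰,z¹ ∈ ℝ. Define C̄ := max((C+N₀)² − 2κ, 0)·(ā+|a̲|)²T² + (2C + ((C+N₀)C/2)e^{κT})·(ā+|a̲|)T + (C/2)e^{κT} + (C²/16)e^{2κT} + N₀ + 1. Then for every t ∈ [0,T], every p ∈ [0,1], every y ∈ ℝ with |y| ≤ (ā+|a̲|)(T−t), and every (z⁰,z¹) ∈ ℝ², one has −L^{z⁰,z¹}(t,y,p; −2y, N_φ) ≥ −(C̄ − 1), where N_φ is the symmetric 2×2 matrix with (N_φ)_yy = −2 and (N_φ)_yp = (N_φ)_pp = 0. Equivalently, the function φ(t,y) := C̄(T−t) − y² satisfies −∂_tφ(t,y) + H(t, y, p, ∂_yφ(t,y), ∂_{yy}φ(t,y)) ≥ 1 ≥ 0 on this region (a classical supersolution inequality for the state-constrained HJB equation).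 -/
/-- `λ̄(p,z⁰,z¹) := p·A⁰(z⁰) + (1−p)·A¹(z¹)`. -/
noncomputable def lamBar (Amax : Fin 2 → ℝ → ℝ) (p z0 z1 : ℝ) : ℝ :=
  p * Amax 0 z0 + (1 - p) * Amax 1 z1

/-- The running reward
`ℓ(t,z⁰,z¹,p) := λ̄ + (e^{κ(T−t)}/2)(H⁰(z⁰) + H¹(z¹) − λ̄(z⁰+z¹))`. -/
noncomputable def runCost (a_min a_max T κ : ℝ) (c Amax : Fin 2 → ℝ → ℝ)
    (t z0 z1 p : ℝ) : ℝ :=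
  lamBar Amax p z0 z1 +
    Real.exp (κ * (T - t)) / 2 *
      (Ham a_min a_max c 0 z0 + Ham a_min a_max c 1 z1
        - lamBar Amax p z0 z1 * (z0 + z1))

/-- The generator `L^{z⁰,z¹}(t,y,p;q,N)` where the symmetric 2×2 matrix `N` is
given by its entries `Nyy, Nyp, Npp`. -/
noncomputable def gen (a_min a_max T κ : ℝ) (c Amax : Fin 2 → ℝ → ℝ)
    (z0 z1 t y p q Nyy Nyp Npp : ℝ) : ℝ :=
  (-(Ham a_min a_max c 0 z0) + Ham a_min a_max c 1 z1 + κ * y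
      + lamBar Amax p z0 z1 * (z0 - z1)) * q
    + 1 / 2 * (z0 - z1) ^ 2 * Nyy
    + (z0 - z1) * p * (1 - p) * (Amax 0 z0 - Amax 1 z1) * Nyp
    + 1 / 2 * p ^ 2 * (1 - p) ^ 2 * (Amax 0 z0 - Amax 1 z1) ^ 2 * Npp
    + runCost a_min a_max T κ c Amax t z0 z1 p

/-- The HJB Hamiltonian `H(t,y,p,q,N) := inf_{(z⁰,z¹)∈ℝ²} (−L^{z⁰,z¹}(t,y,p;q,N))`. -/
noncomputable def HJBHam (a_min a_max T κ : ℝ) (c Amax : Fin 2 → ℝ → ℝ)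
    (t y p q Nyy Nyp Npp : ℝ) : ℝ :=
  sInf (Set.range fun zz : ℝ × ℝ =>
    -(gen a_min a_max T κ c Amax zz.1 zz.2 t y p q Nyy Nyp Npp))

/-- Supersolution inequality: with `C̄` as indicated, the function
`φ(t,y) = C̄(T−t) − y²` satisfies `−L^{z⁰,z¹}(t,y,p;∂_yφ,∇²φ) ≥ −(C̄−1)` for all controls,
equivalently `−∂_tφ + H(t,y,p,∂_yφ,∂_{yy}φ) ≥ 1 ≥ 0`, on
`{|y| ≤ (ā+|a̲|)(T−t)}`. -/
theorem stmt_11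
    (a_min a_max ρ N0 T κ C : ℝ)
    (hA : a_min < a_max) (hρ : 0 < ρ) (hT : 0 < T) (hκ : 0 < κ)
    (c c' c'' : Fin 2 → ℝ → ℝ)
    (hc' : ∀ θ : Fin 2, ∀ α ∈ Set.Icc a_min a_max, HasDerivAt (c θ) (c' θ α) α)
    (hc'' : ∀ θ : Fin 2, ∀ α ∈ Set.Icc a_min a_max, HasDerivAt (c' θ) (c'' θ α) α)
    (hc''cont : ∀ θ : Fin 2, ContinuousOn (c'' θ) (Set.Icc a_min a_max))
    (hconv : ∀ θ : Fin 2, ∀ α ∈ Set.Icc a_min a_max, ρ ≤ c'' θ α)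
    (hN0 : ∀ θ : Fin 2, ∀ α ∈ Set.Icc a_min a_max, |c' θ α| + |α| ≤ N0)
    (Amax : Fin 2 → ℝ → ℝ)
    (hAmax : ∀ θ : Fin 2, ∀ z : ℝ, IsMaximizer a_min a_max c θ z (Amax θ z))
    (alow abar : ℝ)
    (halow : alow = sInf (Set.range fun z =>
      Ham a_min a_max c 0 z - Ham a_min a_max c 1 z))
    (habar : abar = sSup (Set.range fun z =>
      Ham a_min a_max c 0 z - Ham a_min a_max c 1 z))
    (hC : 0 ≤ C)
    (hC1 : ∀ z0 z1 : ℝ,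
      |Ham a_min a_max c 1 z1 - Ham a_min a_max c 0 z0| ≤ C * (1 + |z0 - z1|))
    (hC2 : ∀ p ∈ Set.Icc (0:ℝ) 1, ∀ z0 z1 : ℝ,
      |Ham a_min a_max c 0 z0 + Ham a_min a_max c 1 z1
          - lamBar Amax p z0 z1 * (z0 + z1)| ≤ C * (1 + |z0 - z1|))
    (Cbar : ℝ)
    (hCbar : Cbar =
      max ((C + N0) ^ 2 - 2 * κ) 0 * (abar + |alow|) ^ 2 * T ^ 2
        + (2 * C + (C + N0) * C / 2 * Real.exp (κ * T)) * (abar + |alow|) * T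
        + C / 2 * Real.exp (κ * T) + C ^ 2 / 16 * Real.exp (2 * κ * T) + N0 + 1) :
    ∀ t ∈ Set.Icc (0:ℝ) T, ∀ p ∈ Set.Icc (0:ℝ) 1, ∀ y : ℝ,
      |y| ≤ (abar + |alow|) * (T - t) →
      (∀ z0 z1 : ℝ,
        -(gen a_min a_max T κ c Amax z0 z1 t y p (-(2 * y)) (-2) 0 0) ≥ -(Cbar - 1)) ∧
      Cbar + HJBHam a_min a_max T κ c Amax t y p (-(2 * y)) (-2) 0 0 ≥ 1 ∧
      Cbar + HJBHam a_min a_max T κ c Amax t y p (-(2 * y)) (-2) 0 0 ≥ 0 := by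
  intro t ht p hp y hy
  obtain ⟨ht0, htT⟩ := ht
  have hAb : ∀ (θ : Fin 2) (z : ℝ), |Amax θ z| ≤ N0 := by
    intro θ z
    have h := hN0 θ _ (hAmax θ z).1
    have h2 := abs_nonneg (c' θ (Amax θ z))
    linarith
  have hN0' : 0 ≤ N0 := (abs_nonneg _).trans (hAb 0 0)
  have hlam : ∀ z0 z1 : ℝ, |lamBar Amax p z0 z1| ≤ N0 := by
    intro z0 z1
    have h0 := abs_le.1 (hAb 0 z0)
    have h1 := abs_le.1 (hAb 1 z1)
    have hp0 := hp.1
    have hp1 : 0 ≤ 1 - p := by linarith [hp.2]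
    unfold lamBar
    rw [abs_le]
    constructor
    · have e1 := mul_le_mul_of_nonneg_left h0.1 hp0
      have e2 := mul_le_mul_of_nonneg_left h1.1 hp1
      linarith
    · have e1 := mul_le_mul_of_nonneg_left h0.2 hp0
      have e2 := mul_le_mul_of_nonneg_left h1.2 hp1
      linarith
  have hb : ∀ z : ℝ, |Ham a_min a_max c 1 z - Ham a_min a_max c 0 z| ≤ C := by
    intro z
    have := hC1 z z
    simpa using this
  have hS : 0 ≤ abar + |alow| := by
    have hle : alow ≤ Ham a_min a_max c 0 0 - Ham a_min a_max c 1 0 := by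
      rw [halow]
      refine csInf_le ⟨-C, ?_⟩ ⟨0, rfl⟩
      rintro _ ⟨z, rfl⟩
      have := abs_le.1 (hb z)
      show -C ≤ Ham a_min a_max c 0 z - Ham a_min a_max c 1 z
      linarith
    have hge : Ham a_min a_max c 0 0 - Ham a_min a_max c 1 0 ≤ abar := by
      rw [habar]
      refine le_csSup ⟨C, ?_⟩ ⟨0, rfl⟩
      rintro _ ⟨z, rfl⟩
      have := abs_le.1 (hb z)
      show Ham a_min a_max c 0 z - Ham a_min a_max c 1 z ≤ C
      linarith
    have := neg_abs_le alow
    linarith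
  have hYS : |y| ≤ (abar + |alow|) * T :=
    hy.trans (mul_le_mul_of_nonneg_left (by linarith) hS)
  have hY0 := abs_nonneg y
  have hE : Real.exp (κ * (T - t)) ≤ Real.exp (κ * T) :=
    Real.exp_le_exp.2 (mul_le_mul_of_nonneg_left (by linarith) hκ.le)
  have hE0 := Real.exp_pos (κ * (T - t))
  have hE2 : Real.exp (2 * κ * T) = Real.exp (κ * T) ^ 2 := by
    rw [← Real.exp_nat_mul]; congr 1; push_cast; ring
  rw [hE2] at hCbar
  have main : ∀ z0 z1 : ℝ,
      -(gen a_min a_max T κ c Amax z0 z1 t y p (-(2 * y)) (-2) 0 0) ≥ -(Cbar - 1) := by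
    intro z0 z1
    have k1 := hC1 z0 z1
    have k2 := (abs_le.1 (hC2 p hp z0 z1)).2
    have k3 := hlam z0 z1
    unfold gen runCost
    set h0 := Ham a_min a_max c 0 z0
    set h1 := Ham a_min a_max c 1 z1
    set l := lamBar Amax p z0 z1
    set E := Real.exp (κ * (T - t))
    set F := Real.exp (κ * T)
    set S := abar + |alow|
    set R := h0 + h1 - l * (z0 + z1)
    set d := |z0 - z1| with hd
    have hd0 : 0 ≤ d := abs_nonneg _
    have hd2 : (z0 - z1) ^ 2 = d ^ 2 := (sq_abs _).symm
    set Y := |y| with hYd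
    have hY2 : y ^ 2 = Y ^ 2 := (sq_abs _).symm
    have m1 : -(y * (h1 - h0 + l * (z0 - z1))) ≤ Y * (C * (1 + d) + N0 * d) := by
      refine (neg_le_abs _).trans ?_
      rw [abs_mul]
      refine mul_le_mul_of_nonneg_left ((abs_add_le _ _).trans ?_) hY0
      rw [abs_mul]
      exact add_le_add k1 (mul_le_mul_of_nonneg_right k3 hd0)
    have m2 : E / 2 * R ≤ E / 2 * (C * (1 + d)) :=
      mul_le_mul_of_nonneg_left k2 (by positivity)
    have m3 : l ≤ N0 := (le_abs_self _).trans k3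
    have m4 : 0 ≤ (d - (Y * (C + N0) + E * C / 4)) ^ 2 := sq_nonneg _
    have n1 : ((C + N0) ^ 2 - 2 * κ) * Y ^ 2 ≤
        max ((C + N0) ^ 2 - 2 * κ) 0 * (S * T) ^ 2 :=
      mul_le_mul (le_max_left _ _) (pow_le_pow_left₀ hY0 hYS 2) (sq_nonneg _)
        (le_max_right _ _)
    have hCN : 0 ≤ (C + N0) * C / 2 := by positivity
    have n2 : (2 * C + (C + N0) * C / 2 * E) * Y ≤
        (2 * C + (C + N0) * C / 2 * F) * (S * T) := by
      refine mul_le_mul ?_ hYS hY0 ?_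
      · linarith [mul_le_mul_of_nonneg_left hE hCN]
      · have : 0 ≤ F := hE0.le.trans hE
        positivity
    have n3 : C / 2 * E ≤ C / 2 * F := mul_le_mul_of_nonneg_left hE (by positivity)
    have n4 : C ^ 2 / 16 * E ^ 2 ≤ C ^ 2 / 16 * F ^ 2 :=
      mul_le_mul_of_nonneg_left (pow_le_pow_left₀ hE0.le hE 2) (by positivity)
    rw [hCbar, hd2]
    have key : (-h0 + h1 + κ * y + l * (z0 - z1)) * -(2 * y) =
        2 * -(y * (h1 - h0 + l * (z0 - z1))) - 2 * κ * Y ^ 2 := by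
      rw [← hY2]; ring
    rw [key]
    linarith
  have hinf : -(Cbar - 1) ≤ HJBHam a_min a_max T κ c Amax t y p (-(2 * y)) (-2) 0 0 := by
    refine le_csInf (Set.range_nonempty _) ?_
    rintro _ ⟨zz, rfl⟩
    exact main zz.1 zz.2
  exact ⟨main, by linarith, by linarith⟩
end

section
/- Assume C ≥ 0 is such that |H¹(z¹) − H⁰(z⁰)| ≤ C(1+|z⁰−z¹|) and |H⁰(z⁰) + H¹(z¹) − λ̄(p,z⁰,z¹)(z⁰+z¹)| ≤ C(1+|z⁰−z¹|) for all p ∈ [0,1] and z⁰,z¹ ∈ ℝ. Define C̲ := −(2κ(ā+|a̲|)²T² + 2C(ā+|a̲|)T + (C/2)e^{κT} + N₀ + 1). Then for every t ∈ [0,T], every p ∈ [0,1], and every y ∈ ℝ with |y| ≤ (ā+|a̲|)(T−t), one has C̲ + H(t, y, p, −2y, N_ψ) ≤ −1 ≤ 0, where N_ψ is the symmetric 2×2 matrix with (N_ψ)_yy = −2 and (N_ψ)_yp = (N_ψ)_pp = 0; equivalently, the function ψ(t,y) := C̲(T−t) − y² satisfies the classical subsolution inequality −∂_tψ(t,y)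 + H(t, y, p, ∂_yψ(t,y), ∂_{yy}ψ(t,y)) ≤ 0 on this region. -/
/-- Subsolution inequality: with `C̲` as indicated, the function
`ψ(t,y) = C̲(T−t) − y²` satisfies `C̲ + H(t,y,p,∂_yψ,∂_{yy}ψ) ≤ −1 ≤ 0` on
`{|y| ≤ (ā+|a̲|)(T−t)}`, i.e. `−∂_tψ + H(t,y,p,∂_yψ,∂_{yy}ψ) ≤ 0`. -/
theorem stmt_12
    (a_min a_max ρ N0 T κ C : ℝ)
    (hA : a_min < a_max) (hρ : 0 < ρ) (hT : 0 < T) (hκ : 0 < κ)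
    (c c' c'' : Fin 2 → ℝ → ℝ)
    (hc' : ∀ θ : Fin 2, ∀ α ∈ Set.Icc a_min a_max, HasDerivAt (c θ) (c' θ α) α)
    (hc'' : ∀ θ : Fin 2, ∀ α ∈ Set.Icc a_min a_max, HasDerivAt (c' θ) (c'' θ α) α)
    (hc''cont : ∀ θ : Fin 2, ContinuousOn (c'' θ) (Set.Icc a_min a_max))
    (hconv : ∀ θ : Fin 2, ∀ α ∈ Set.Icc a_min a_max, ρ ≤ c'' θ α)
    (hN0 : ∀ θ : Fin 2, ∀ α ∈ Set.Icc a_min a_max, |c' θ α| + |α| ≤ N0)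
    (Amax : Fin 2 → ℝ → ℝ)
    (hAmax : ∀ θ : Fin 2, ∀ z : ℝ, IsMaximizer a_min a_max c θ z (Amax θ z))
    (alow abar : ℝ)
    (halow : alow = sInf (Set.range fun z =>
      Ham a_min a_max c 0 z - Ham a_min a_max c 1 z))
    (habar : abar = sSup (Set.range fun z =>
      Ham a_min a_max c 0 z - Ham a_min a_max c 1 z))
    (hC : 0 ≤ C)
    (hC1 : ∀ z0 z1 : ℝ,
      |Ham a_min a_max c 1 z1 - Ham a_min a_max c 0 z0| ≤ C * (1 + |z0 - z1|))
    (hC2 : ∀ p ∈ Set.Icc (0:ℝ) 1, ∀ z0 z1 : ℝ,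
      |Ham a_min a_max c 0 z0 + Ham a_min a_max c 1 z1
          - lamBar Amax p z0 z1 * (z0 + z1)| ≤ C * (1 + |z0 - z1|))
    (Clow : ℝ)
    (hClow : Clow =
      -(2 * κ * (abar + |alow|) ^ 2 * T ^ 2 + 2 * C * (abar + |alow|) * T
        + C / 2 * Real.exp (κ * T) + N0 + 1)) :
    ∀ t ∈ Set.Icc (0:ℝ) T, ∀ p ∈ Set.Icc (0:ℝ) 1, ∀ y : ℝ,
      |y| ≤ (abar + |alow|) * (T - t) →
      Clow + HJBHam a_min a_max T κ c Amax t y p (-(2 * y)) (-2) 0 0 ≤ -1 ∧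
      Clow + HJBHam a_min a_max T κ c Amax t y p (-(2 * y)) (-2) 0 0 ≤ 0 := by
  intro t ht p hp y hy
  suffices h : Clow + HJBHam a_min a_max T κ c Amax t y p (-(2 * y)) (-2) 0 0 ≤ -1 from
    ⟨h, by linarith⟩
  obtain ⟨ht0, htT⟩ := ht
  -- bounds on the maximizers
  have hA' : ∀ θ z, |Amax θ z| ≤ N0 := fun θ z => by
    have h1 := hN0 θ _ (hAmax θ z).1
    have h2 := abs_nonneg (c' θ (Amax θ z))
    linarith
  have hN0nn : 0 ≤ N0 := (abs_nonneg _).trans (hA' 0 0)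
  -- nonnegativity of the width
  have hb : ∀ z, |Ham a_min a_max c 0 z - Ham a_min a_max c 1 z| ≤ C := fun z => by
    have h := hC1 z z
    rw [abs_sub_comm] at h
    simpa using h
  have hlow : alow ≤ Ham a_min a_max c 0 0 - Ham a_min a_max c 1 0 := by
    rw [halow]
    refine csInf_le ⟨-C, ?_⟩ ⟨0, rfl⟩
    rintro _ ⟨z, rfl⟩
    exact (abs_le.1 (hb z)).1
  have hbar : Ham a_min a_max c 0 0 - Ham a_min a_max c 1 0 ≤ abar := by
    rw [habar]
    refine le_csSup ⟨C, ?_⟩ ⟨0, rfl⟩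
    rintro _ ⟨z, rfl⟩
    exact (abs_le.1 (hb z)).2
  have hS : 0 ≤ abar + |alow| := by
    have := neg_abs_le alow
    linarith
  generalize abar + |alow| = S at *
  have hyS : |y| ≤ S * T := hy.trans (mul_le_mul_of_nonneg_left (by linarith) hS)
  have hST : 0 ≤ S * T := mul_nonneg hS hT.le
  have hy2 : y ^ 2 ≤ (S * T) ^ 2 := by
    rw [← sq_abs y]
    exact pow_le_pow_left₀ (abs_nonneg y) hyS 2
  have e1 : 0 < Real.exp (κ * (T - t)) := Real.exp_pos _
  have e2 : Real.exp (κ * (T - t)) ≤ Real.exp (κ * T) :=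
    Real.exp_le_exp.2 (mul_le_mul_of_nonneg_left (by linarith) hκ.le)
  unfold HJBHam
  by_cases hbd : BddBelow (Set.range fun zz : ℝ × ℝ =>
    -(gen a_min a_max T κ c Amax zz.1 zz.2 t y p (-(2 * y)) (-2) 0 0))
  · have h := csInf_le hbd ⟨((0:ℝ), (0:ℝ)), rfl⟩
    refine (add_le_add le_rfl h).trans ?_
    have hl : |lamBar Amax p 0 0| ≤ N0 := by
      have h0 := abs_le.1 (hA' 0 0)
      have h1 := abs_le.1 (hA' 1 0)
      have hp0 := hp.1
      have hp1 : 0 ≤ 1 - p := by linarith [hp.2]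
      unfold lamBar
      rw [abs_le]
      constructor <;> nlinarith
    have h1 := hb 0
    have h2 := hC2 p hp 0 0
    simp only [sub_self, add_zero, mul_zero, abs_zero, mul_one, sub_zero] at h2
    simp only [gen, runCost, sub_self, add_zero, mul_zero, zero_mul, sub_zero]
    generalize lamBar Amax p 0 0 = l at *
    generalize Ham a_min a_max c 0 0 = A at *
    generalize Ham a_min a_max c 1 0 = B at *
    have k1 : -((A - B) * y) ≤ C * (S * T) := by
      calc -((A - B) * y) ≤ |(A - B) * y| := neg_le_abs _
        _ = |A - B| * |y| := abs_mul _ _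
        _ ≤ C * (S * T) := mul_le_mul h1 hyS (abs_nonneg _) hC
    have k2 : -(Real.exp (κ * (T - t)) * (A + B)) ≤ Real.exp (κ * T) * C := by
      calc -(Real.exp (κ * (T - t)) * (A + B)) ≤ |Real.exp (κ * (T - t)) * (A + B)| := neg_le_abs _
        _ = Real.exp (κ * (T - t)) * |A + B| := by rw [abs_mul, abs_of_pos e1]
        _ ≤ Real.exp (κ * T) * C := mul_le_mul e2 h2 (abs_nonneg _) (e1.le.trans e2)
    have k3 := mul_le_mul_of_nonneg_left hy2 hκ.le
    have k4 := (abs_le.1 hl).1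
    rw [hClow]
    linarith
  · rw [Real.sInf_of_not_bddBelow hbd, hClow]
    have : 0 ≤ 2 * κ * S ^ 2 * T ^ 2 := by positivity
    have : 0 ≤ 2 * C * S * T := by positivity
    have : 0 ≤ C / 2 * Real.exp (κ * T) := by positivity
    linarith
end

section
/- Fix λ ≥ 0, t ∈ [0,T], y, q ∈ ℝ, p ∈ [0,1], and a real symmetric 2×2 matrix N. (a) If N_yy < 0, then the set {−L^{λ,z⁰,z¹}(t,y,p;q,N) : (z⁰,z¹) ∈ ℝ²} is bounded below and its infimum H^λ(t,y,p,q,N) is attained at some (z⁰,z¹) ∈ ℝ²; in particular H^λ(t,y,p,q,N) is a (finite) real number. (b) If N_yy > 0, then this set is unbounded below, i.e. for every M ∈ ℝ there exists (z⁰,z¹) ∈ ℝ² with −L^{λ,z⁰,z¹}(t,y,p;q,N) < M. -/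
/-- The rescaled generator `L^{λ,z⁰,z¹}(t,y,p;q,N)` (with running reward `e^{λt}·ℓ`),
where the symmetric 2×2 matrix `N` is given by its entries `Nyy, Nyp, Npp`. -/
noncomputable def genL (a_min a_max T κ lam : ℝ) (c Amax : Fin 2 → ℝ → ℝ)
    (z0 z1 t y p q Nyy Nyp Npp : ℝ) : ℝ :=
  (-(Ham a_min a_max c 0 z0) + Ham a_min a_max c 1 z1 + κ * y
      + lamBar Amax p z0 z1 * (z0 - z1)) * q
    + 1 / 2 * (z0 - z1) ^ 2 * Nyy
    + (z0 - z1) * p * (1 - p) * (Amax 0 z0 - Amax 1 z1) * Nyp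
    + 1 / 2 * p ^ 2 * (1 - p) ^ 2 * (Amax 0 z0 - Amax 1 z1) ^ 2 * Npp
    + Real.exp (lam * t) * runCost a_min a_max T κ c Amax t z0 z1 p

/-- `H^λ(t,y,p,q,N) := inf_{(z⁰,z¹)∈ℝ²} (−L^{λ,z⁰,z¹}(t,y,p;q,N))`. -/
noncomputable def HJBHamL (a_min a_max T κ lam : ℝ) (c Amax : Fin 2 → ℝ → ℝ)
    (t y p q Nyy Nyp Npp : ℝ) : ℝ :=
  sInf (Set.range fun zz : ℝ × ℝ =>
    -(genL a_min a_max T κ lam c Amax zz.1 zz.2 t y p q Nyy Nyp Npp))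

open Asymptotics in
theorem aux_top_bound {a_min a_max K Cc : ℝ} (hK : 0 ≤ K)
    (a0 a1 c0 c1 : ℝ → ℝ)
    (h0 : ∀ z, a0 z ∈ Set.Icc a_min a_max) (h1 : ∀ z, a1 z ∈ Set.Icc a_min a_max)
    (hc0 : ∀ z, |c0 z| ≤ Cc) (hc1 : ∀ z, |c1 z| ≤ Cc)
    (h0p : ∀ z, K < z → a0 z = a_max) (h1p : ∀ z, K < z → a1 z = a_max)
    (h0m : ∀ z, z < -K → a0 z = a_min) (h1m : ∀ z, z < -K → a1 z = a_min)
    (p q yy Nyp Npp e E : ℝ) :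
    ∃ C : ℝ, ∀ zz : ℝ × ℝ,
      |(-(1 - p) * ((a0 zz.1 - a1 zz.2) * zz.1) - p * ((a0 zz.1 - a1 zz.2) * zz.2)
          + c0 zz.1 - c1 zz.2 + yy) * q
        + (zz.1 - zz.2) * p * (1 - p) * (a0 zz.1 - a1 zz.2) * Nyp
        + 1 / 2 * p ^ 2 * (1 - p) ^ 2 * (a0 zz.1 - a1 zz.2) ^ 2 * Npp
        + e * (p * a0 zz.1 + (1 - p) * a1 zz.2 + E / 2 *
          ((1 - p) * ((a0 zz.1 - a1 zz.2) * zz.1) - p * ((a0 zz.1 - a1 zz.2) * zz.2)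
            - c0 zz.1 - c1 zz.2))| ≤ C * (1 + |zz.1 - zz.2|) := by
  set g : ℝ × ℝ → ℝ := fun zz => 1 + |zz.1 - zz.2| with hg
  have hgn : ∀ zz, ‖g zz‖ = 1 + |zz.1 - zz.2| := fun zz => by
    rw [Real.norm_eq_abs, abs_of_nonneg]; positivity
  have hbd : ∀ (f : ℝ × ℝ → ℝ) (B : ℝ), (∀ zz, |f zz| ≤ B) → f =O[⊤] g := by
    intro f B hB
    rw [isBigO_top]
    refine ⟨B, fun zz => ?_⟩
    rw [hgn, Real.norm_eq_abs]
    have := hB zz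
    have h2 := abs_nonneg (f zz)
    have h3 := abs_nonneg (zz.1 - zz.2)
    nlinarith
  have hD : ∀ zz : ℝ × ℝ, |a0 zz.1 - a1 zz.2| ≤ a_max - a_min := fun zz => by
    have := h0 zz.1; have := h1 zz.2
    simp only [Set.mem_Icc] at *
    rw [abs_le]; constructor <;> linarith
  have hW : 0 ≤ a_max - a_min := (abs_nonneg _).trans (hD (0, 0))
  have key : ∀ zz : ℝ × ℝ, a0 zz.1 - a1 zz.2 = 0 ∨
      (|zz.1| ≤ K + |zz.1 - zz.2| ∧ |zz.2| ≤ K + |zz.1 - zz.2|) := by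
    rintro ⟨z, w⟩
    simp only
    by_cases hp : K < z ∧ K < w
    · left; rw [h0p z hp.1, h1p w hp.2, sub_self]
    by_cases hm : z < -K ∧ w < -K
    · left; rw [h0m z hm.1, h1m w hm.2, sub_self]
    right
    rcases abs_cases z with ⟨h, _⟩ | ⟨h, _⟩ <;> rcases abs_cases w with ⟨h', _⟩ | ⟨h', _⟩ <;>
      rcases abs_cases (z - w) with ⟨h'', _⟩ | ⟨h'', _⟩ <;> rw [h, h', h''] <;> grind
  have hmul : ∀ (f : ℝ × ℝ → ℝ), (∀ zz : ℝ × ℝ, a0 zz.1 - a1 zz.2 = 0 ∨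
      |f zz| ≤ K + |zz.1 - zz.2|) → (fun zz : ℝ × ℝ => (a0 zz.1 - a1 zz.2) * f zz) =O[⊤] g := by
    intro f hf
    rw [isBigO_top]
    refine ⟨(a_max - a_min) * (K + 1), fun zz => ?_⟩
    rw [hgn, Real.norm_eq_abs]
    have h3 := abs_nonneg (zz.1 - zz.2)
    rcases hf zz with h | h
    · rw [h]; simp; positivity
    · rw [abs_mul, mul_assoc]
      refine mul_le_mul (hD zz) (h.trans ?_) (abs_nonneg _) hW
      nlinarith
  have b1 := hmul (fun zz => zz.1) fun zz => (key zz).imp id And.left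
  have b2 := hmul (fun zz => zz.2) fun zz => (key zz).imp id And.right
  have b3 := hmul (fun zz => zz.1 - zz.2) fun zz => Or.inr (by linarith)
  have b4 := hbd (fun zz => c0 zz.1) Cc fun zz => hc0 _
  have b5 := hbd (fun zz => c1 zz.2) Cc fun zz => hc1 _
  have b6 := hbd (fun zz => (a0 zz.1 - a1 zz.2) ^ 2) ((a_max - a_min) ^ 2) fun zz => by
    rw [abs_pow]; exact pow_le_pow_left₀ (abs_nonneg _) (hD zz) 2
  have b7 := hbd (fun zz => a0 zz.1) (max |a_min| |a_max|) fun zz =>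
    abs_le_max_abs_abs (h0 _).1 (h0 _).2
  have b8 := hbd (fun zz => a1 zz.2) (max |a_min| |a_max|) fun zz =>
    abs_le_max_abs_abs (h1 _).1 (h1 _).2
  have b9 := hbd (fun zz => yy * q) |yy * q| fun zz => le_rfl
  have tot := ((((((((b1.const_mul_left (-(1 - p) * q + e * E / 2 * (1 - p))).add
    (b2.const_mul_left (-p * q - e * E / 2 * p))).add
    (b4.const_mul_left (q - e * E / 2))).add
    (b5.const_mul_left (-q - e * E / 2))).add b9).add
    (b3.const_mul_left (p * (1 - p) * Nyp))).add
    (b6.const_mul_left (1 / 2 * p ^ 2 * (1 - p) ^ 2 * Npp))).add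
    (b7.const_mul_left (e * p))).add (b8.const_mul_left (e * (1 - p)))
  rw [isBigO_top] at tot
  obtain ⟨C, hC⟩ := tot
  refine ⟨C, fun zz => ?_⟩
  have := hC zz
  rw [hgn, Real.norm_eq_abs] at this
  refine le_trans (le_of_eq ?_) this
  congr 1
  ring

theorem aux_cont (a0 a1 g0 g1 : ℝ × ℝ → ℝ) (e0 : Continuous a0) (e1 : Continuous a1)
    (e2 : Continuous g0) (e3 : Continuous g1) (yy p q Nyy Nyp Npp e E : ℝ) :
    Continuous fun zz : ℝ × ℝ =>
      -((-(zz.1 * a0 zz - g0 zz) + (zz.2 * a1 zz - g1 zz) + yy +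
                (p * a0 zz + (1 - p) * a1 zz) * (zz.1 - zz.2)) * q +
            1 / 2 * (zz.1 - zz.2) ^ 2 * Nyy +
          (zz.1 - zz.2) * p * (1 - p) * (a0 zz - a1 zz) * Nyp +
        1 / 2 * p ^ 2 * (1 - p) ^ 2 * (a0 zz - a1 zz) ^ 2 * Npp +
      e * (p * a0 zz + (1 - p) * a1 zz + E / 2 *
            (zz.1 * a0 zz - g0 zz + (zz.2 * a1 zz - g1 zz) -
              (p * a0 zz + (1 - p) * a1 zz) * (zz.1 + zz.2)))) := by
  fun_prop

theorem aux_foc {a b z α β d : ℝ} {c : ℝ → ℝ} (hα : α ∈ Set.Icc a b)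
    (hmax : ∀ β ∈ Set.Icc a b, z * β - c β ≤ z * α - c α)
    (hd : HasDerivAt c d α) (hβ : β ∈ Set.Icc a b) : (z - d) * (β - α) ≤ 0 := by
  have hder : HasDerivAt (fun x => z * x - c x) (z - d) α := by
    have h := ((hasDerivAt_id α).const_mul z).sub hd
    rw [mul_one] at h
    exact h
  have hm : IsMaxOn (fun x => z * x - c x) (Set.Icc a b) α := fun β hβ => hmax β hβ
  have := hm.localize.hasFDerivWithinAt_nonpos hder.hasFDerivAt.hasFDerivWithinAt
    (y := β - α) (sub_mem_posTangentConeAt_of_segment_subset ((convex_Icc a b).segment_subset hα hβ))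
  simpa [mul_comm] using this

theorem aux_single (a_min a_max ρ : ℝ) (hA : a_min < a_max) (hρ : 0 < ρ)
    (c c' c'' A : ℝ → ℝ)
    (hc' : ∀ α ∈ Set.Icc a_min a_max, HasDerivAt c (c' α) α)
    (hc'' : ∀ α ∈ Set.Icc a_min a_max, HasDerivAt c' (c'' α) α)
    (hconv : ∀ α ∈ Set.Icc a_min a_max, ρ ≤ c'' α)
    (hmem : ∀ z, A z ∈ Set.Icc a_min a_max)
    (hmax : ∀ z, ∀ β ∈ Set.Icc a_min a_max, z * β - c β ≤ z * A z - c (A z)) :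
    Continuous A ∧ Continuous (fun z => c (A z)) ∧ (∃ Cc, ∀ z, |c (A z)| ≤ Cc) ∧
    ∃ K, 0 ≤ K ∧ (∀ z, K < z → A z = a_max) ∧ (∀ z, z < -K → A z = a_min) := by
  have foc : ∀ z, ∀ β ∈ Set.Icc a_min a_max, (z - c' (A z)) * (β - A z) ≤ 0 := fun z β hβ =>
    aux_foc (hmem z) (hmax z) (hc' _ (hmem z)) hβ
  have cc : ContinuousOn c (Set.Icc a_min a_max) := fun x hx =>
    (hc' x hx).continuousAt.continuousWithinAt
  have cc' : ContinuousOn c' (Set.Icc a_min a_max) := fun x hx =>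
    (hc'' x hx).continuousAt.continuousWithinAt
  have mono : ∀ x ∈ Set.Icc a_min a_max, ∀ y ∈ Set.Icc a_min a_max, x ≤ y →
      ρ * (y - x) ≤ c' y - c' x := by
    intro x hx y hy hxy
    refine (convex_Icc a_min a_max).mul_sub_le_image_sub_of_le_deriv cc' ?_ ?_ x hx y hy hxy
    · intro u hu
      exact (hc'' u (interior_subset hu)).differentiableAt.differentiableWithinAt
    · intro u hu
      rw [(hc'' u (interior_subset hu)).deriv]; exact hconv u (interior_subset hu)
  have lip : ∀ z w, |A z - A w| ≤ ρ⁻¹ * |z - w| := by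
    have half : ∀ z w, A z ≤ A w → |A z - A w| ≤ ρ⁻¹ * |z - w| := by
      intro z w h
      have m := mono _ (hmem z) _ (hmem w) h
      have f1 := foc z _ (hmem w)
      have f2 := foc w _ (hmem z)
      rw [← div_eq_inv_mul, le_div_iff₀ hρ, abs_of_nonpos (by linarith)]
      rcases h.eq_or_lt with h | h
      · rw [h]; simp
      · have g1 : z - c' (A z) ≤ 0 := by by_contra hh; nlinarith
        have g2 : 0 ≤ w - c' (A w) := by by_contra hh; nlinarith
        have := neg_abs_le (z - w)
        nlinarith
    intro z w
    rcases le_total (A z) (A w) with h | h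
    · exact half z w h
    · rw [abs_sub_comm, abs_sub_comm z]; exact half w z h
  have contA : Continuous A := by
    have : LipschitzWith (Real.toNNReal ρ⁻¹) A := LipschitzWith.of_dist_le' (K := ρ⁻¹)
      fun x y => by rw [Real.dist_eq, Real.dist_eq]; exact lip x y
    exact this.continuous
  refine ⟨contA, cc.comp_continuous contA hmem, ?_, ?_⟩
  · obtain ⟨C, hC⟩ := isCompact_Icc.exists_bound_of_continuousOn cc
    exact ⟨C, fun z => hC _ (hmem z)⟩
  · obtain ⟨C, hC⟩ := isCompact_Icc.exists_bound_of_continuousOn cc'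
    have hC0 := (norm_nonneg _).trans (hC _ (hmem 0))
    refine ⟨C, hC0, fun z hz => ?_, fun z hz => ?_⟩
    · have f := foc z a_max ⟨hA.le, le_rfl⟩
      have b := abs_le.1 (hC _ (hmem z))
      have m := hmem z
      refine le_antisymm m.2 ?_
      by_contra hh
      nlinarith [b.2, mul_pos (show 0 < z - c' (A z) by linarith [b.2])
        (show 0 < a_max - A z by linarith)]
    · have f := foc z a_min ⟨le_rfl, hA.le⟩
      have b := abs_le.1 (hC _ (hmem z))
      have m := hmem z
      refine le_antisymm ?_ m.1
      by_contra hh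
      nlinarith [b.1, mul_pos (show 0 < c' (A z) - z by linarith [b.1])
        (show 0 < A z - a_min by linarith)]

theorem aux_quad {a C B : ℝ} (ha : 0 < a) (hC : 0 ≤ C) : ∃ R, 0 < R ∧ ∀ x : ℝ, R ≤ |x| →
    B < a * x ^ 2 - C * (1 + |x|) := by
  refine ⟨1 + (2 * C + |B|) / a, by positivity, fun x hx => ?_⟩
  have h1 : 1 ≤ |x| := le_trans (by linarith [show 0 ≤ (2 * C + |B|) / a by positivity]) hx
  have h2 : a + (2 * C + |B|) ≤ a * |x| := by
    have := mul_le_mul_of_nonneg_left hx ha.le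
    rwa [mul_add, mul_one, mul_div_cancel₀ _ ha.ne'] at this
  rw [← sq_abs x]
  have h3 := mul_le_mul_of_nonneg_right h2 (abs_nonneg x)
  have h4 := le_abs_self B
  have h5 := abs_nonneg B
  nlinarith

theorem aux_min {f : ℝ × ℝ → ℝ} (hf : Continuous f) {K a C : ℝ} (hK : 0 ≤ K) (ha : 0 < a)
    (hC : 0 ≤ C) (hb : ∀ zz : ℝ × ℝ, a * (zz.1 - zz.2) ^ 2 - C * (1 + |zz.1 - zz.2|) ≤ f zz)
    (hp : ∀ z w s, K < z → K < w → K < z - s → K < w - s → f (z, w) = f (z - s, w - s))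
    (hm : ∀ z w s, z < -K → w < -K → z + s < -K → w + s < -K →
      f (z, w) = f (z + s, w + s)) :
    ∃ x, ∀ zz, f x ≤ f zz := by
  obtain ⟨R, hR, hq⟩ := aux_quad (B := f (0, 0)) ha hC
  set Q := K + R + 1 with hQ
  have hcpt : IsCompact (Set.Icc (-Q) Q ×ˢ Set.Icc (-Q) Q) := isCompact_Icc.prod isCompact_Icc
  have h0 : ((0, 0) : ℝ × ℝ) ∈ Set.Icc (-Q) Q ×ˢ Set.Icc (-Q) Q := by
    simp only [Set.mem_prod, Set.mem_Icc]
    refine ⟨⟨?_, ?_⟩, ?_, ?_⟩ <;> linarith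
  obtain ⟨x, -, hx⟩ := hcpt.exists_isMinOn ⟨_, h0⟩ hf.continuousOn
  have hx' : ∀ z w, -Q ≤ z → z ≤ Q → -Q ≤ w → w ≤ Q → f x ≤ f (z, w) := fun z w h1 h2 h3 h4 =>
    hx (show (z, w) ∈ Set.Icc (-Q) Q ×ˢ Set.Icc (-Q) Q from ⟨⟨h1, h2⟩, h3, h4⟩)
  refine ⟨x, fun zz => ?_⟩
  obtain ⟨z, w⟩ := zz
  rcases le_or_gt R |z - w| with h | h
  · exact (hx h0).trans ((hq _ h).le.trans (hb (z, w)))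
  obtain ⟨hl, hr⟩ := abs_lt.1 h
  by_cases hup : K + 1 ≤ z ∧ K + 1 ≤ w
  · rcases le_total z w with hzw | hzw
    · rw [hp z w (z - (K + 1)) (by linarith) (by linarith) (by linarith) (by linarith)]
      apply hx' <;> linarith
    · rw [hp z w (w - (K + 1)) (by linarith) (by linarith) (by linarith) (by linarith)]
      apply hx' <;> linarith
  by_cases hdn : z ≤ -(K + 1) ∧ w ≤ -(K + 1)
  · rcases le_total z w with hzw | hzw
    · rw [hm z w (-w - (K + 1)) (by linarith) (by linarith) (by linarith) (by linarith)]
      apply hx' <;> linarith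
    · rw [hm z w (-z - (K + 1)) (by linarith) (by linarith) (by linarith) (by linarith)]
      apply hx' <;> linarith
  rw [not_and_or, not_le, not_le] at hup hdn
  apply hx' <;> rcases hup with h1 | h1 <;> rcases hdn with h2 | h2 <;> linarith

/-- (a) If `N_yy < 0`, the family `{−L^{λ,z⁰,z¹}(t,y,p;q,N)}` is bounded below and its
infimum `H^λ(t,y,p,q,N)` is attained, so it is a finite real number.
(b) If `N_yy > 0`, the family is unbounded below. -/
theorem stmt_13
    (a_min a_max ρ T κ lam : ℝ)
    (hA : a_min < a_max) (hρ : 0 < ρ) (hT : 0 < T) (hκ : 0 < κ) (hlam : 0 ≤ lam)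
    (c c' c'' : Fin 2 → ℝ → ℝ)
    (hc' : ∀ θ : Fin 2, ∀ α ∈ Set.Icc a_min a_max, HasDerivAt (c θ) (c' θ α) α)
    (hc'' : ∀ θ : Fin 2, ∀ α ∈ Set.Icc a_min a_max, HasDerivAt (c' θ) (c'' θ α) α)
    (hc''cont : ∀ θ : Fin 2, ContinuousOn (c'' θ) (Set.Icc a_min a_max))
    (hconv : ∀ θ : Fin 2, ∀ α ∈ Set.Icc a_min a_max, ρ ≤ c'' θ α)
    (Amax : Fin 2 → ℝ → ℝ)
    (hAmax : ∀ θ : Fin 2, ∀ z : ℝ, IsMaximizer a_min a_max c θ z (Amax θ z))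
    (t y p q Nyy Nyp Npp : ℝ)
    (ht : t ∈ Set.Icc (0:ℝ) T) (hp : p ∈ Set.Icc (0:ℝ) 1) :
    (Nyy < 0 →
      ∃ z0 z1 : ℝ,
        IsLeast
          (Set.range fun zz : ℝ × ℝ =>
            -(genL a_min a_max T κ lam c Amax zz.1 zz.2 t y p q Nyy Nyp Npp))
          (-(genL a_min a_max T κ lam c Amax z0 z1 t y p q Nyy Nyp Npp)) ∧
        HJBHamL a_min a_max T κ lam c Amax t y p q Nyy Nyp Npp
          = -(genL a_min a_max T κ lam c Amax z0 z1 t y p q Nyy Nyp Npp)) ∧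
    (0 < Nyy →
      ∀ M : ℝ, ∃ z0 z1 : ℝ,
        -(genL a_min a_max T κ lam c Amax z0 z1 t y p q Nyy Nyp Npp) < M) := by
  have hHam : ∀ θ z, Ham a_min a_max c θ z = z * Amax θ z - c θ (Amax θ z) := by
    intro θ z
    refine IsGreatest.csSup_eq ⟨⟨_, (hAmax θ z).1, rfl⟩, ?_⟩
    rintro _ ⟨β, hβ, rfl⟩
    exact (hAmax θ z).2 β hβ
  have hS := fun θ => aux_single a_min a_max ρ hA hρ (c θ) (c' θ) (c'' θ) (Amax θ) (hc' θ)
    (hc'' θ) (hconv θ) (fun z => (hAmax θ z).1) (fun z => (hAmax θ z).2)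
  obtain ⟨cA0, cc0, ⟨C0, hC0⟩, K0, hK0, p0, m0⟩ := hS 0
  obtain ⟨cA1, cc1, ⟨C1, hC1⟩, K1, hK1, p1, m1⟩ := hS 1
  set K := max K0 K1 with hK
  have hKn : 0 ≤ K := hK0.trans (le_max_left _ _)
  have p0' : ∀ z, K < z → Amax 0 z = a_max := fun z hz => p0 z ((le_max_left _ _).trans_lt hz)
  have p1' : ∀ z, K < z → Amax 1 z = a_max := fun z hz => p1 z ((le_max_right _ _).trans_lt hz)
  have m0' : ∀ z, z < -K → Amax 0 z = a_min := fun z hz =>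
    m0 z (hz.trans_le (neg_le_neg (le_max_left _ _)))
  have m1' : ∀ z, z < -K → Amax 1 z = a_min := fun z hz =>
    m1 z (hz.trans_le (neg_le_neg (le_max_right _ _)))
  obtain ⟨C', hC'⟩ := aux_top_bound (Cc := max C0 C1) hKn (Amax 0) (Amax 1)
    (fun z => c 0 (Amax 0 z)) (fun z => c 1 (Amax 1 z))
    (fun z => (hAmax 0 z).1) (fun z => (hAmax 1 z).1)
    (fun z => (hC0 z).trans (le_max_left _ _)) (fun z => (hC1 z).trans (le_max_right _ _))
    p0' p1' m0' m1' p q (κ * y) Nyp Npp (Real.exp (lam * t)) (Real.exp (κ * (T - t)))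
  obtain ⟨C, hC, hCn⟩ : ∃ C, (∀ zz : ℝ × ℝ,
      |genL a_min a_max T κ lam c Amax zz.1 zz.2 t y p q Nyy Nyp Npp
        - 1 / 2 * Nyy * (zz.1 - zz.2) ^ 2| ≤ C * (1 + |zz.1 - zz.2|)) ∧ 0 ≤ C := by
    refine ⟨C', fun zz => ?_, ?_⟩
    · refine le_trans (le_of_eq ?_) (hC' zz)
      congr 1
      simp only [genL, runCost, hHam, lamBar]
      ring
    · have := (abs_nonneg _).trans (hC' (0, 0))
      simpa using this
  constructor
  · intro hN
    have hcont : Continuous (fun zz : ℝ × ℝ =>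
        -(genL a_min a_max T κ lam c Amax zz.1 zz.2 t y p q Nyy Nyp Npp)) := by
      simp only [genL, runCost, hHam, lamBar]
      have e0 : Continuous (fun zz : ℝ × ℝ => Amax 0 zz.1) := cA0.comp continuous_fst
      have e1 : Continuous (fun zz : ℝ × ℝ => Amax 1 zz.2) := cA1.comp continuous_snd
      have e2 : Continuous (fun zz : ℝ × ℝ => c 0 (Amax 0 zz.1)) := cc0.comp continuous_fst
      have e3 : Continuous (fun zz : ℝ × ℝ => c 1 (Amax 1 zz.2)) := cc1.comp continuous_snd
      exact aux_cont _ _ _ _ e0 e1 e2 e3 _ _ _ _ _ _ _ _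
    obtain ⟨x, hx⟩ := aux_min hcont (K := K) (a := -(1 / 2 * Nyy)) (C := C) hKn (by linarith) hCn
      (fun zz => by have := (abs_le.1 (hC zz)).2; linarith)
      (fun z w s h1 h2 h3 h4 => by
        simp only [genL, runCost, hHam, lamBar, p0' _ h1, p1' _ h2, p0' _ h3, p1' _ h4]
        ring)
      (fun z w s h1 h2 h3 h4 => by
        simp only [genL, runCost, hHam, lamBar, m0' _ h1, m1' _ h2, m0' _ h3, m1' _ h4]
        ring)
    have hl : IsLeast (Set.range fun zz : ℝ × ℝ =>
            -(genL a_min a_max T κ lam c Amax zz.1 zz.2 t y p q Nyy Nyp Npp))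
          (-(genL a_min a_max T κ lam c Amax x.1 x.2 t y p q Nyy Nyp Npp)) := by
      refine ⟨⟨x, rfl⟩, ?_⟩
      rintro _ ⟨zz, rfl⟩
      exact hx zz
    exact ⟨x.1, x.2, hl, hl.csInf_eq⟩
  · intro hN M
    obtain ⟨R, hR, hq⟩ := aux_quad (a := 1 / 2 * Nyy) (C := C) (B := -M) (by linarith) hCn
    refine ⟨R, 0, ?_⟩
    have h1 := hq R (le_abs_self R)
    have h2 := (abs_le.1 (hC (R, 0))).1
    simp only [sub_zero] at h2
    linarith
end

section
/- In the non-dominated example, for each θ ∈ {0,1} and z ∈ ℝ, the function α ↦ z·α − (½α² + (−1)^{θ+1}α) attains its maximum over A = [a̲/2, ā/2] at the unique point A^θ(z) = min(max(z + (−1)^θ, a̲/2), ā/2) (the projection of z + (−1)^θ onto A); moreover inf_{z∈ℝ}(H⁰(z) − H¹(z)) = a̲ and sup_{z∈ℝ}(H⁰(z) − H¹(z)) = ā. -/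
/-- Cost of the non-dominated example: `c(θ,α) = ½α² + (−1)^{θ+1}α`. -/
noncomputable def costN (θ : Fin 2) (α : ℝ) : ℝ :=
  1 / 2 * α ^ 2 + (-1 : ℝ) ^ ((θ : ℕ) + 1) * α

/-- Hamiltonian of the non-dominated example:
`H^θ(z) = sup_{α ∈ [a̲/2, ā/2]} (z·α − c(θ,α))`. -/
noncomputable def HamN (alow abar : ℝ) (θ : Fin 2) (z : ℝ) : ℝ :=
  sSup ((fun α => z * α - costN θ α) '' Set.Icc (alow / 2) (abar / 2))

/-- Quantitative optimality of the projection. -/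
theorem proj_opt (l u w β : ℝ) (hlu : l ≤ u) (hl : l ≤ β) (hu : β ≤ u) :
    (w * β - β ^ 2 / 2) + (min (max w l) u - β) ^ 2 / 2
      ≤ w * min (max w l) u - (min (max w l) u) ^ 2 / 2 := by
  have key : 0 ≤ (w - min (max w l) u) * (min (max w l) u - β) := by
    rcases le_total w l with h | h
    · rw [max_eq_right h, min_eq_left hlu]; nlinarith
    · rw [max_eq_left h]
      rcases le_total w u with h' | h'
      · rw [min_eq_left h']; simp
      · rw [min_eq_right h']; nlinarith
  nlinarith

theorem obj_eq (θ : Fin 2) (z β : ℝ) :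
    z * β - costN θ β = (z + (-1 : ℝ) ^ (θ : ℕ)) * β - β ^ 2 / 2 := by
  unfold costN; rw [pow_succ]; ring

theorem proj_mem (l u w : ℝ) (hlu : l ≤ u) : min (max w l) u ∈ Set.Icc l u :=
  ⟨le_min (le_max_right _ _) hlu, min_le_right _ _⟩

theorem HamN_eq (alow abar : ℝ) (h : alow / 2 ≤ abar / 2) (θ : Fin 2) (z w : ℝ)
    (hw : w = z + (-1 : ℝ) ^ (θ : ℕ)) :
    HamN alow abar θ z = w * min (max w (alow / 2)) (abar / 2)
      - (min (max w (alow / 2)) (abar / 2)) ^ 2 / 2 := by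
  subst hw
  unfold HamN
  apply IsGreatest.csSup_eq
  refine ⟨⟨_, proj_mem _ _ _ h, obj_eq _ _ _⟩, ?_⟩
  rintro _ ⟨β, hβ, rfl⟩
  have := proj_opt (alow / 2) (abar / 2) (z + (-1 : ℝ) ^ (θ : ℕ)) β h hβ.1 hβ.2
  simp only [obj_eq]
  nlinarith [sq_nonneg (min (max (z + (-1 : ℝ) ^ (θ : ℕ)) (alow / 2)) (abar / 2) - β)]

/-- Non-dominated example: for each `θ` and `z`, `α ↦ z·α − (½α² + (−1)^{θ+1}α)` attains
its maximum over `A = [a̲/2, ā/2]` at the unique point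
`min(max(z + (−1)^θ, a̲/2), ā/2)`; moreover `inf_z (H⁰(z) − H¹(z)) = a̲` and
`sup_z (H⁰(z) − H¹(z)) = ā`. -/
theorem stmt_18 (alow abar : ℝ) (halow : alow < 0) (habar : 0 < abar) :
    (∀ θ : Fin 2, ∀ z : ℝ,
      (min (max (z + (-1 : ℝ) ^ (θ : ℕ)) (alow / 2)) (abar / 2)
          ∈ Set.Icc (alow / 2) (abar / 2) ∧
        ∀ β ∈ Set.Icc (alow / 2) (abar / 2),
          z * β - costN θ β
            ≤ z * min (max (z + (-1 : ℝ) ^ (θ : ℕ)) (alow / 2)) (abar / 2)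
              - costN θ (min (max (z + (-1 : ℝ) ^ (θ : ℕ)) (alow / 2)) (abar / 2))) ∧
      (∀ α ∈ Set.Icc (alow / 2) (abar / 2),
        (∀ β ∈ Set.Icc (alow / 2) (abar / 2),
            z * β - costN θ β ≤ z * α - costN θ α) →
        α = min (max (z + (-1 : ℝ) ^ (θ : ℕ)) (alow / 2)) (abar / 2))) ∧
    sInf (Set.range fun z => HamN alow abar 0 z - HamN alow abar 1 z) = alow ∧
    sSup (Set.range fun z => HamN alow abar 0 z - HamN alow abar 1 z) = abar := by
  have hlu : alow / 2 ≤ abar / 2 := by linarith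
  have h0 : ∀ z, HamN alow abar 0 z = _ := fun z => HamN_eq alow abar hlu 0 z (z + 1) (by simp)
  have h1 : ∀ z, HamN alow abar 1 z = _ := fun z => HamN_eq alow abar hlu 1 z (z - 1) (by simp; ring)
  refine ⟨fun θ z => ⟨⟨proj_mem _ _ _ hlu, fun β hβ => ?_⟩, fun α hα hmax => ?_⟩, ?_, ?_⟩
  · have := proj_opt (alow / 2) (abar / 2) (z + (-1 : ℝ) ^ (θ : ℕ)) β hlu hβ.1 hβ.2
    simp only [obj_eq]
    nlinarith [sq_nonneg (min (max (z + (-1 : ℝ) ^ (θ : ℕ)) (alow / 2)) (abar / 2) - β)]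
  · have h2 := proj_opt (alow / 2) (abar / 2) (z + (-1 : ℝ) ^ (θ : ℕ)) α hlu hα.1 hα.2
    have h3 := hmax _ (proj_mem _ _ (z + (-1 : ℝ) ^ (θ : ℕ)) hlu)
    simp only [obj_eq] at h3
    have h4 : (min (max (z + (-1 : ℝ) ^ (θ : ℕ)) (alow / 2)) (abar / 2) - α) ^ 2 = 0 :=
      le_antisymm (by linarith) (sq_nonneg _)
    have h5 := pow_eq_zero_iff (two_ne_zero) |>.1 h4
    linarith
  · apply IsLeast.csInf_eq
    refine ⟨⟨alow / 2 - 1, ?_⟩, ?_⟩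
    · simp only [h0, h1]
      rw [max_eq_right (by linarith), max_eq_right (by linarith), min_eq_left hlu]
      ring
    · rintro _ ⟨z, rfl⟩
      simp only [h0, h1]
      obtain ⟨ha, hb⟩ := proj_mem (alow / 2) (abar / 2) (z - 1) hlu
      have := proj_opt (alow / 2) (abar / 2) (z + 1) _ hlu ha hb
      nlinarith [sq_nonneg (min (max (z + 1) (alow / 2)) (abar / 2)
        - min (max (z - 1) (alow / 2)) (abar / 2))]
  · apply IsGreatest.csSup_eq
    refine ⟨⟨abar / 2 + 1, ?_⟩, ?_⟩
    · simp only [h0, h1]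
      rw [min_eq_right (le_max_of_le_left (by linarith)),
        min_eq_right (le_max_of_le_left (by linarith))]
      ring
    · rintro _ ⟨z, rfl⟩
      simp only [h0, h1]
      obtain ⟨ha, hb⟩ := proj_mem (alow / 2) (abar / 2) (z + 1) hlu
      have := proj_opt (alow / 2) (abar / 2) (z - 1) _ hlu ha hb
      nlinarith [sq_nonneg (min (max (z - 1) (alow / 2)) (abar / 2)
        - min (max (z + 1) (alow / 2)) (abar / 2))]
end

section
/- In the non-dominated example, for z ∈ ℝ one has H⁰(z) − H¹(z) = ā if and only if z ≥ ā/2 + 1; and for every z ≥ ā/2 + 1 the two maximizers coincide, A⁰(z) = A¹(z) = ā/2, and the identity H⁰(z) + H¹(z) − ā·z = −ā²/4 holds. -/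
/-- Non-dominated example: `H⁰(z) − H¹(z) = ā` iff `z ≥ ā/2 + 1`; and for every
`z ≥ ā/2 + 1` the maximizers coincide, `A⁰(z) = A¹(z) = ā/2`, and
`H⁰(z) + H¹(z) − ā·z = −ā²/4`. -/
theorem stmt_19 (alow abar : ℝ) (halow : alow < 0) (habar : 0 < abar)
    (Amax : Fin 2 → ℝ → ℝ)
    (hAmax : ∀ θ : Fin 2, ∀ z : ℝ,
      Amax θ z ∈ Set.Icc (alow / 2) (abar / 2) ∧
      ∀ β ∈ Set.Icc (alow / 2) (abar / 2),
        z * β - costN θ β ≤ z * Amax θ z - costN θ (Amax θ z)) :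
    (∀ z : ℝ, (HamN alow abar 0 z - HamN alow abar 1 z = abar ↔ abar / 2 + 1 ≤ z)) ∧
    (∀ z : ℝ, abar / 2 + 1 ≤ z →
      Amax 0 z = abar / 2 ∧
      Amax 1 z = abar / 2 ∧
      HamN alow abar 0 z + HamN alow abar 1 z - abar * z = -(abar ^ 2 / 4)) := by
  have hc0 : ∀ α, costN 0 α = 1 / 2 * α ^ 2 - α := by
    intro α; simp [costN]; ring
  have hc1 : ∀ α, costN 1 α = 1 / 2 * α ^ 2 + α := by
    intro α; simp [costN]
  have hH : ∀ θ z, HamN alow abar θ z = z * Amax θ z - costN θ (Amax θ z) := by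
    intro θ z
    apply IsGreatest.csSup_eq
    refine ⟨⟨Amax θ z, (hAmax θ z).1, rfl⟩, ?_⟩
    rintro _ ⟨β, hβ, rfl⟩
    exact (hAmax θ z).2 β hβ
  have hb : abar / 2 ∈ Set.Icc (alow / 2) (abar / 2) := ⟨by linarith, le_rfl⟩
  have h0 : ∀ z, abar / 2 + 1 ≤ z → Amax 0 z = abar / 2 := by
    intro z hz
    obtain ⟨⟨_, h2⟩, h3⟩ := hAmax 0 z
    have h4 := h3 _ hb
    rw [hc0, hc0] at h4
    by_contra hne
    have hlt := lt_of_le_of_ne h2 hne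
    nlinarith [mul_pos (sub_pos.2 hlt) (sub_pos.2 hlt)]
  have h1 : ∀ z, abar / 2 + 1 ≤ z → Amax 1 z = abar / 2 := by
    intro z hz
    obtain ⟨⟨_, h2⟩, h3⟩ := hAmax 1 z
    have h4 := h3 _ hb
    rw [hc1, hc1] at h4
    by_contra hne
    have hlt := lt_of_le_of_ne h2 hne
    nlinarith [mul_pos (sub_pos.2 hlt) (sub_pos.2 hlt)]
  refine ⟨fun z => ⟨fun h => ?_, fun hz => ?_⟩, fun z hz => ⟨h0 z hz, h1 z hz, ?_⟩⟩
  · rw [hH, hH] at h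
    obtain ⟨hp, _⟩ := hAmax 0 z
    obtain ⟨_, hq⟩ := hAmax 1 z
    have hpq := hq _ hp
    simp only [hc0, hc1] at h hpq hq
    have hpe : Amax 0 z = abar / 2 := le_antisymm hp.2 (by linarith)
    rw [hpe] at h
    by_contra hlt
    push Not at hlt
    rcases le_total 0 (z - 1) with hw | hw
    · have := hq (z - 1) ⟨by linarith, by linarith⟩
      have h5 : 0 < abar / 2 - (z - 1) := by linarith
      nlinarith [mul_pos h5 h5]
    · have := hq 0 ⟨by linarith, by linarith⟩
      nlinarith [mul_pos habar habar, mul_nonneg habar.le (neg_nonneg.2 hw)]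
  · rw [hH, hH, h0 z hz, h1 z hz, hc0, hc1]; ring
  · rw [hH, hH, h0 z hz, h1 z hz, hc0, hc1]; ring
end
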